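/- Let (M,B) be a quadratic Malcev superalgebra, D an odd skew-supersymmetric Malcev operator, and A_0 ∈ M_0 satisfying the four compatibility conditions D²(A_0) = (1/2)A_0A_0, D(A_0X) = A_0D(X) - D(A_0)X, (A_0X)Y = D(D(X)Y) + D²(XY) + (-1)^{x}D(X)D(Y) + (-1)^{xy}D²(Y)X, and A_0(XY) = D(D(X)Y) + D²(X)Y - (-1)^{xy}{D²(Y)X + D(D(Y)X)}. Then k = K e ⊕ M ⊕ K e* (with e, e* odd), with multiplication ee = A_0, eX = D(X) - (-1)^{x}B(X,A_0)e*, XY = (XY)_M - B(D(X),Y)e* for X,Y ∈ M, and e* k = 0, is a Malcev superalgebra. -/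

import Mathlib

open scoped BigOperators

/-- The sign `(-1)^(x·y)` for degrees `x, y ∈ ℤ/2`. -/
def sgn (K : Type) [Field K] (x y : ZMod 2) : K := (-1 : K) ^ (x.val * y.val)

section Defs

variable (K : Type) [Field K] (V : Type) [AddCommGroup V] [Module K V]

/-- `(g, mul)` is a Malcev superalgebra structure on `V`:  a `ℤ/2`-grading by submodules
which is a direct sum decomposition, such that the (bilinear) multiplication respects the
grading, is graded skew-symmetric (`XY = -(-1)^{xy} YX`) and satisfies the graded Malcev
identity. -/
def IsMalcevSuper (g : ZMod 2 → Submodule K V) (mul : V →ₗ[K] V →ₗ[K] V) : Prop :=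
  DirectSum.IsInternal g ∧
    (∀ x y X Y, X ∈ g x → Y ∈ g y → mul X Y ∈ g (x + y)) ∧
    (∀ x y X Y, X ∈ g x → Y ∈ g y → mul X Y = -(sgn K x y) • mul Y X) ∧
    (∀ x y z t X Y Z T, X ∈ g x → Y ∈ g y → Z ∈ g z → T ∈ g t →
      sgn K y z • mul (mul X Z) (mul Y T) =
        mul (mul (mul X Y) Z) T + sgn K x (y + z + t) • mul (mul (mul Y Z) T) X +
          sgn K (x + y) (z + t) • mul (mul (mul Z T) X) Y +
          sgn K t (x + y + z) • mul (mul (mul T X) Y) Z)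

/-- `B` is an invariant scalar product: even, supersymmetric, non-degenerate, invariant. -/
def IsQuadratic (g : ZMod 2 → Submodule K V) (mul : V →ₗ[K] V →ₗ[K] V)
    (B : V →ₗ[K] V →ₗ[K] K) : Prop :=
  (∀ x y X Y, X ∈ g x → Y ∈ g y → x ≠ y → B X Y = 0) ∧
    (∀ x y X Y, X ∈ g x → Y ∈ g y → B X Y = sgn K x y * B Y X) ∧
    (∀ X, (∀ Y, B X Y = 0) → X = 0) ∧
    (∀ X Y Z, B (mul X Y) Z = B X (mul Y Z))

/-- A linear endomorphism is homogeneous of degree `α`. -/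
def IsHomogMap (g : ZMod 2 → Submodule K V) (α : ZMod 2) (φ : V →ₗ[K] V) : Prop :=
  ∀ x X, X ∈ g x → φ X ∈ g (x + α)

/-- Malcev operator identity for a homogeneous endomorphism `φ`. -/
def IsMalcevOp (g : ZMod 2 → Submodule K V) (mul : V →ₗ[K] V →ₗ[K] V)
    (φ : V →ₗ[K] V) : Prop :=
  ∀ x y z X Y Z, X ∈ g x → Y ∈ g y → Z ∈ g z →
    φ (mul (mul X Y) Z) =
      mul (mul (φ X) Y) Z - sgn K x y • mul (φ Y) (mul X Z) -
        sgn K z (x + y) • mul (mul (φ Z) X) Y - sgn K x (y + z) • mul (φ (mul Y Z)) X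

/-- `φ` (homogeneous of degree `α`) is skew-supersymmetric with respect to `B`. -/
def IsSkewSuper (g : ZMod 2 → Submodule K V) (B : V →ₗ[K] V →ₗ[K] K) (α : ZMod 2)
    (φ : V →ₗ[K] V) : Prop :=
  ∀ x X Y, X ∈ g x → B (φ X) Y = -(sgn K α x) * B X (φ Y)

/-- Scalar-valued Malcev 2-cocycle. -/
def IsCocycle (g : ZMod 2 → Submodule K V) (mul : V →ₗ[K] V →ₗ[K] V)
    (ω : V →ₗ[K] V →ₗ[K] K) : Prop :=
  (∀ x y X Y, X ∈ g x → Y ∈ g y → ω X Y = -(sgn K x y) * ω Y X) ∧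
    (∀ x y z t X Y Z T, X ∈ g x → Y ∈ g y → Z ∈ g z → T ∈ g t →
      sgn K y z * ω (mul X Z) (mul Y T) =
        ω (mul (mul X Y) Z) T + sgn K x (y + z + t) * ω (mul (mul Y Z) T) X +
          sgn K (x + y) (z + t) * ω (mul (mul Z T) X) Y +
          sgn K t (x + y + z) * ω (mul (mul T X) Y) Z)

/-- The four compatibility conditions on an odd operator `D` and `A₀ ∈ M₀` entering the
generalized double extension. -/
def GDEConds (g : ZMod 2 → Submodule K V) (mul : V →ₗ[K] V →ₗ[K] V)
    (D : V →ₗ[K] V) (A0 : V) : Prop :=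
  D (D A0) = (1 / 2 : K) • mul A0 A0 ∧
    (∀ X, D (mul A0 X) = mul A0 (D X) - mul (D A0) X) ∧
    (∀ x y X Y, X ∈ g x → Y ∈ g y →
      mul (mul A0 X) Y =
        D (mul (D X) Y) + D (D (mul X Y)) + ((-1 : K) ^ x.val) • mul (D X) (D Y) +
          sgn K x y • mul (D (D Y)) X) ∧
    (∀ x y X Y, X ∈ g x → Y ∈ g y →
      mul A0 (mul X Y) =
        D (mul (D X) Y) + mul (D (D X)) Y -
          sgn K x y • (mul (D (D Y)) X + D (mul (D Y) X)))

/-- The grading of the generalized double extension `Ke ⊕ M ⊕ Ke*` (with `e`, `e*` odd),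
realized on the carrier `K × V × K`. -/
def gdeGrading (g : ZMod 2 → Submodule K V) : ZMod 2 → Submodule K (K × V × K) := fun x =>
  if x = 0 then (⊥ : Submodule K K).prod ((g 0).prod (⊥ : Submodule K K))
  else (⊤ : Submodule K K).prod ((g 1).prod (⊤ : Submodule K K))

/-- The multiplication of the generalized double extension `k = Ke ⊕ M ⊕ Ke*`:
`ee = A₀`, `eX = D(X) - (-1)^x B(X,A₀)e*`, `XY = (XY)_M - B(D(X),Y)e*`, `e* k = 0`
(and `Xe = -(-1)^x eX` by graded skew-symmetry), written out bilinearly on the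
carrier `K × V × K` (coordinates: coefficient of `e`, element of `M`, coefficient of `e*`). -/
def GDEMulFormula (g : ZMod 2 → Submodule K V) (mul : V →ₗ[K] V →ₗ[K] V)
    (B : V →ₗ[K] V →ₗ[K] K) (D : V →ₗ[K] V) (A0 : V)
    (mulE : (K × V × K) →ₗ[K] (K × V × K) →ₗ[K] (K × V × K)) : Prop :=
  ∀ (p q : ZMod 2) (a c b d : K) (X Y : V), X ∈ g p → Y ∈ g q →
    mulE (a, X, c) (b, Y, d) =
      (0, (a * b) • A0 + mul X Y + a • D Y - ((-1 : K) ^ p.val * b) • D X,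
        -(a * (-1 : K) ^ q.val * B Y A0) + b * B X A0 - B (D X) Y)

/-- `B`-irreducibility: every graded ideal on which `B` is non-degenerate is trivial. -/
def BIrreducible (g : ZMod 2 → Submodule K V) (mul : V →ₗ[K] V →ₗ[K] V)
    (B : V →ₗ[K] V →ₗ[K] K) : Prop :=
  ∀ I : Submodule K V, (∀ X ∈ I, ∀ Y, mul X Y ∈ I) →
    I = (I ⊓ g 0) ⊔ (I ⊓ g 1) →
    (∀ X ∈ I, (∀ Y ∈ I, B X Y = 0) → X = 0) → I = ⊥ ∨ I = ⊤

end Defs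

section Signs

variable {K : Type} [Field K]

private lemma zmod_two_cases (x : ZMod 2) : x = 0 ∨ x = 1 := by
  revert x; decide

private lemma sgn_zero_left (x : ZMod 2) : sgn K 0 x = 1 := by simp [sgn]

private lemma sgn_zero_right (x : ZMod 2) : sgn K x 0 = 1 := by simp [sgn]

private lemma sgn_one_one : sgn K 1 1 = -1 := by simp [sgn, ZMod.val_one]

private lemma neg_one_pow_zero_val : (-1 : K) ^ (0 : ZMod 2).val = 1 := by simp

private lemma neg_one_pow_one_val : (-1 : K) ^ (1 : ZMod 2).val = -1 := by simp [ZMod.val_one]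

private lemma one_add_one_zmod : (1 + 1 : ZMod 2) = 0 := by decide

end Signs

section MalcevIdentity

variable {K : Type} [Field K] {W : Type} [AddCommGroup W] [Module K W]

/-- The graded Malcev identity for given homogeneous elements `X, Y, Z, T` of degrees
`x, y, z, t`. -/
def MalcevIdentity (μ : W →ₗ[K] W →ₗ[K] W) (x y z t : ZMod 2) (X Y Z T : W) : Prop :=
  sgn K y z • μ (μ X Z) (μ Y T) =
    μ (μ (μ X Y) Z) T + sgn K x (y + z + t) • μ (μ (μ Y Z) T) X +
      sgn K (x + y) (z + t) • μ (μ (μ Z T) X) Y +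
      sgn K t (x + y + z) • μ (μ (μ T X) Y) Z

lemma MalcevIdentity.add {μ : W →ₗ[K] W →ₗ[K] W} {x y z t : ZMod 2} {X X' Y Z T : W}
    (h : MalcevIdentity μ x y z t X Y Z T) (h' : MalcevIdentity μ x y z t X' Y Z T) :
    MalcevIdentity μ x y z t (X + X') Y Z T := by
  unfold MalcevIdentity at *
  simp only [map_add, LinearMap.add_apply]
  linear_combination (norm := module) h + h'

lemma MalcevIdentity.smul {μ : W →ₗ[K] W →ₗ[K] W} {x y z t : ZMod 2} {X Y Z T : W} (a : K)
    (h : MalcevIdentity μ x y z t X Y Z T) :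
    MalcevIdentity μ x y z t (a • X) Y Z T := by
  unfold MalcevIdentity at *
  simp only [map_smul, LinearMap.smul_apply]
  linear_combination (norm := module) a • h

/-- The graded Malcev identity is invariant under cyclic permutations. -/
lemma MalcevIdentity.rotate {μ : W →ₗ[K] W →ₗ[K] W} {h : ZMod 2 → Submodule K W}
    (hcl : ∀ x y X Y, X ∈ h x → Y ∈ h y → μ X Y ∈ h (x + y))
    (hsk : ∀ x y X Y, X ∈ h x → Y ∈ h y → μ X Y = -(sgn K x y) • μ Y X)
    {x y z t : ZMod 2} {X Y Z T : W} (hX : X ∈ h x) (hY : Y ∈ h y) (hZ : Z ∈ h z) (hT : T ∈ h t)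
    (H : MalcevIdentity μ y z t x Y Z T X) : MalcevIdentity μ x y z t X Y Z T := by
  unfold MalcevIdentity at *
  rw [hsk _ _ _ _ hZ hX, map_smul, hsk _ _ _ _ (hcl _ _ _ _ hY hT) (hcl _ _ _ _ hX hZ)] at H
  linear_combination (norm := skip) sgn K x (y + z + t) • H
  rcases zmod_two_cases x with rfl | rfl <;> rcases zmod_two_cases y with rfl | rfl <;>
    rcases zmod_two_cases z with rfl | rfl <;> rcases zmod_two_cases t with rfl | rfl <;>
    simp only [sgn_zero_left, sgn_zero_right, sgn_one_one, one_add_one_zmod, add_zero,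
      zero_add] <;> module

end MalcevIdentity

section Extension

variable {K : Type} [Field K] {V : Type} [AddCommGroup V] [Module K V]
  {g : ZMod 2 → Submodule K V} {mul : V →ₗ[K] V →ₗ[K] V} {B : V →ₗ[K] V →ₗ[K] K}
  {D : V →ₗ[K] V} {A0 : V} {mulE : (K × V × K) →ₗ[K] (K × V × K) →ₗ[K] (K × V × K)}

private lemma exists_even_add_odd (hg : DirectSum.IsInternal g) (X : V) :
    ∃ X0 ∈ g 0, ∃ X1 ∈ g 1, X0 + X1 = X := by
  have h := (DirectSum.isInternal_submodule_iff_isCompl g (i := 0) (j := 1) (by decide)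
    (by ext x; simpa using zmod_two_cases x)).1 hg
  exact Submodule.mem_sup.1 (h.sup_eq_top ▸ Submodule.mem_top)

lemma mem_gdeGrading_zero {u : K × V × K} :
    u ∈ gdeGrading K V g 0 ↔ u.1 = 0 ∧ u.2.1 ∈ g 0 ∧ u.2.2 = 0 := by
  simp [gdeGrading, Submodule.mem_prod]

lemma mem_gdeGrading_one {u : K × V × K} : u ∈ gdeGrading K V g 1 ↔ u.2.1 ∈ g 1 := by
  simp [gdeGrading, Submodule.mem_prod]

lemma isInternal_gdeGrading (hg : DirectSum.IsInternal g) :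
    DirectSum.IsInternal (gdeGrading K V g) := by
  have h01 : (0 : ZMod 2) ≠ 1 := by decide
  have huniv : (Set.univ : Set (ZMod 2)) = {0, 1} := by ext x; simpa using zmod_two_cases x
  rw [DirectSum.isInternal_submodule_iff_isCompl _ h01 huniv]
  have hc := (DirectSum.isInternal_submodule_iff_isCompl g h01 huniv).1 hg
  refine ⟨Submodule.disjoint_def.2 ?_, codisjoint_iff.2 (eq_top_iff.2 ?_)⟩
  · rintro ⟨a, X, c⟩ h0 h1
    obtain ⟨rfl, hX, rfl⟩ : a = 0 ∧ X ∈ g 0 ∧ c = 0 := mem_gdeGrading_zero.1 h0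
    rw [Submodule.disjoint_def.1 hc.disjoint X hX (mem_gdeGrading_one.1 h1)]
    rfl
  · rintro ⟨a, X, c⟩ -
    obtain ⟨X0, h0, X1, h1, rfl⟩ := exists_even_add_odd hg X
    exact Submodule.mem_sup.2 ⟨(0, X0, 0), mem_gdeGrading_zero.2 ⟨rfl, h0, rfl⟩, (a, X1, c),
      mem_gdeGrading_one.2 h1, by simp⟩

variable (g) in
/-- The homogeneous generators of `Ke ⊕ M ⊕ Ke*`: homogeneous elements of `M`, `e` and `e*`. -/
def IsGenerator (x : ZMod 2) (u : K × V × K) : Prop :=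
  (∃ X ∈ g x, u = (0, X, 0)) ∨ (x = 1 ∧ u = (1, 0, 0)) ∨ (x = 1 ∧ u = (0, 0, 1))

lemma IsGenerator.mem {x : ZMod 2} {u : K × V × K} (h : IsGenerator g x u) :
    u ∈ gdeGrading K V g x := by
  rcases h with ⟨X, hX, rfl⟩ | ⟨rfl, rfl⟩ | ⟨rfl, rfl⟩
  · rcases zmod_two_cases x with rfl | rfl
    · exact mem_gdeGrading_zero.2 ⟨rfl, hX, rfl⟩
    · exact mem_gdeGrading_one.2 hX
  · exact mem_gdeGrading_one.2 (zero_mem _)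
  · exact mem_gdeGrading_one.2 (zero_mem _)

lemma MalcevIdentity.of_generators {x y z t : ZMod 2} {X Y Z T : K × V × K}
    (hX : X ∈ gdeGrading K V g x)
    (h : ∀ u, IsGenerator g x u → MalcevIdentity mulE x y z t u Y Z T) :
    MalcevIdentity mulE x y z t X Y Z T := by
  obtain ⟨a, X, c⟩ := X
  rcases zmod_two_cases x with rfl | rfl
  · obtain ⟨rfl, h0, rfl⟩ : a = 0 ∧ X ∈ g 0 ∧ c = 0 := mem_gdeGrading_zero.1 hX
    exact h _ (Or.inl ⟨X, h0, rfl⟩)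
  · have e : ((a, X, c) : K × V × K) = (0, X, 0) + (a • (1, 0, 0) + c • (0, 0, 1)) := by simp
    rw [e]
    exact (h _ (Or.inl ⟨X, mem_gdeGrading_one.1 hX, rfl⟩)).add
      (((h _ (Or.inr (Or.inl ⟨rfl, rfl⟩))).smul a).add
        ((h _ (Or.inr (Or.inr ⟨rfl, rfl⟩))).smul c))

variable (g mul B D A0 mulE) in
/-- The data entering a generalized double extension by an odd one-dimensional algebra. -/
structure IsGDEDatum : Prop where
  malcev : IsMalcevSuper K V g mul
  quadratic : IsQuadratic K V g mul B
  odd : IsHomogMap K V g 1 D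
  operator : IsMalcevOp K V g mul D
  skewSuper : IsSkewSuper K V g B 1 D
  even : A0 ∈ g 0
  conds : GDEConds K V g mul D A0
  formula : GDEMulFormula K V g mul B D A0 mulE

namespace IsGDEDatum

lemma mul_mem (H : IsGDEDatum g mul B D A0 mulE)
    {x y : ZMod 2} {X Y : V} (hX : X ∈ g x) (hY : Y ∈ g y) : mul X Y ∈ g (x + y) :=
  H.malcev.2.1 x y X Y hX hY

lemma skew (H : IsGDEDatum g mul B D A0 mulE)
    {x y : ZMod 2} {X Y : V} (hX : X ∈ g x) (hY : Y ∈ g y) :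
    mul X Y = -(sgn K x y) • mul Y X :=
  H.malcev.2.2.1 x y X Y hX hY

lemma invariant (H : IsGDEDatum g mul B D A0 mulE) (X Y Z : V) : B (mul X Y) Z = B X (mul Y Z) :=
  H.quadratic.2.2.2 X Y Z

lemma symm (H : IsGDEDatum g mul B D A0 mulE)
    {x y : ZMod 2} {X Y : V} (hX : X ∈ g x) (hY : Y ∈ g y) :
    B X Y = sgn K x y * B Y X :=
  H.quadratic.2.1 x y X Y hX hY

lemma form_eq_zero (H : IsGDEDatum g mul B D A0 mulE)
    {x y : ZMod 2} {X Y : V} (hX : X ∈ g x) (hY : Y ∈ g y) (h : x ≠ y) :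
    B X Y = 0 :=
  H.quadratic.1 x y X Y hX hY h

lemma D_skew (H : IsGDEDatum g mul B D A0 mulE) {x : ZMod 2} {X : V} (hX : X ∈ g x) (Y : V) :
    B (D X) Y = -((-1 : K) ^ x.val) * B X (D Y) := by
  have h := H.skewSuper x X Y hX
  rcases zmod_two_cases x with rfl | rfl <;> simpa [sgn, ZMod.val_one] using h

lemma mulE_coe_coe (H : IsGDEDatum g mul B D A0 mulE) (X Y : V) (c d : K) :
    mulE (0, X, c) (0, Y, d) = (0, mul X Y, -B (D X) Y) := by
  obtain ⟨X0, hX0, X1, hX1, rfl⟩ := exists_even_add_odd H.malcev.1 X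
  obtain ⟨Y0, hY0, Y1, hY1, rfl⟩ := exists_even_add_odd H.malcev.1 Y
  have e : ((0, X0 + X1, c) : K × V × K) = (0, X0, c) + (0, X1, 0) := by simp
  have e' : ((0, Y0 + Y1, d) : K × V × K) = (0, Y0, d) + (0, Y1, 0) := by simp
  rw [e, e']
  simp only [map_add, LinearMap.add_apply, H.formula _ _ _ _ _ _ _ _ hX0 hY0,
    H.formula _ _ _ _ _ _ _ _ hX0 hY1, H.formula _ _ _ _ _ _ _ _ hX1 hY0,
    H.formula _ _ _ _ _ _ _ _ hX1 hY1]
  ext <;> simp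
  abel

lemma mulE_e_coe (H : IsGDEDatum g mul B D A0 mulE)
    (Y : V) (d : K) : mulE (1, 0, 0) (0, Y, d) = (0, D Y, -B Y A0) := by
  obtain ⟨Y0, hY0, Y1, hY1, rfl⟩ := exists_even_add_odd H.malcev.1 Y
  have e' : ((0, Y0 + Y1, d) : K × V × K) = (0, Y0, d) + (0, Y1, 0) := by simp
  rw [e']
  simp only [map_add, H.formula _ _ _ _ _ _ _ _ (zero_mem (g 0)) hY0,
    H.formula _ _ _ _ _ _ _ _ (zero_mem (g 0)) hY1]
  ext <;> simp [H.form_eq_zero hY1 H.even (by decide)]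

lemma mulE_coe_e (H : IsGDEDatum g mul B D A0 mulE) {x : ZMod 2} {X : V} (hX : X ∈ g x) (c : K) :
    mulE (0, X, c) (1, 0, 0) = (0, -(-1 : K) ^ x.val • D X, B X A0) := by
  rw [H.formula _ _ _ _ _ _ _ _ hX (zero_mem (g 0))]
  simp

lemma mulE_e_e (H : IsGDEDatum g mul B D A0 mulE) : mulE (1, 0, 0) (1, 0, 0) = (0, A0, 0) := by
  rw [H.formula _ _ _ _ _ _ _ _ (zero_mem (g 0)) (zero_mem (g 0))]
  simp

lemma mulE_star_left (H : IsGDEDatum g mul B D A0 mulE) (u : K × V × K) : mulE (0, 0, 1) u = 0 := by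
  obtain ⟨b, Y, d⟩ := u
  have e : ((b, Y, d) : K × V × K) = b • (1, 0, 0) + (0, Y, d) := by simp
  rw [e, map_add, map_smul, H.mulE_coe_coe, H.mulE_coe_e (zero_mem (g 0))]
  simp

lemma mulE_star_right (H : IsGDEDatum g mul B D A0 mulE)
    (u : K × V × K) : mulE u (0, 0, 1) = 0 := by
  obtain ⟨a, X, c⟩ := u
  have e : ((a, X, c) : K × V × K) = a • (1, 0, 0) + (0, X, c) := by simp
  rw [e, map_add, map_smul, LinearMap.add_apply, LinearMap.smul_apply, H.mulE_coe_coe,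
    H.mulE_e_coe]
  simp

lemma sgn_one_mul_form (H : IsGDEDatum g mul B D A0 mulE)
    {x y : ZMod 2} {X Y : V} (hX : X ∈ g x) (hY : Y ∈ g y) :
    sgn K 1 (x + y) * B X Y = B X Y := by
  by_cases h : x = y
  · subst h
    have h2 : x + x = 0 := CharTwo.add_self_eq_zero x
    simp [h2, sgn_zero_right]
  · simp [H.form_eq_zero hX hY h]

lemma form_D_D (H : IsGDEDatum g mul B D A0 mulE) {x : ZMod 2} {X : V} (hX : X ∈ g x) (Y : V) :
    B (D (D X)) Y = -B X (D (D Y)) := by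
  rw [H.D_skew (H.odd _ _ hX), H.D_skew hX]
  rcases zmod_two_cases x with rfl | rfl <;>
    simp only [neg_one_pow_zero_val, neg_one_pow_one_val, one_add_one_zmod, zero_add] <;> ring

lemma form_mul_rotate (H : IsGDEDatum g mul B D A0 mulE)
    {z t w : ZMod 2} {Z T W : V} (hZ : Z ∈ g z) (hT : T ∈ g t)
    (hW : W ∈ g w) : B (mul Z T) W = sgn K t w * sgn K z w * B (mul W Z) T := by
  rw [H.invariant, H.skew hT hW, map_smul, ← H.invariant, H.skew hZ hW]
  simp only [map_smul, LinearMap.smul_apply, smul_eq_mul]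
  ring

lemma mul_self_eq_zero (H : IsGDEDatum g mul B D A0 mulE) [CharZero K] : mul A0 A0 = 0 := by
  have h := H.skew H.even H.even
  rw [sgn_zero_left, neg_one_smul] at h
  have h2 : (2 : K) • mul A0 A0 = 0 := by rw [two_smul]; nth_rewrite 1 [h]; simp
  exact (smul_eq_zero.1 h2).resolve_left two_ne_zero

lemma D_D_eq_zero (H : IsGDEDatum g mul B D A0 mulE) [CharZero K] : D (D A0) = 0 := by
  rw [H.conds.1, H.mul_self_eq_zero, smul_zero]

/-- `ω(X, Y) = -B(D X, Y)` satisfies the cocycle identity. -/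
lemma cocycle (H : IsGDEDatum g mul B D A0 mulE)
    {x y z t : ZMod 2} {X Y Z T : V} (hX : X ∈ g x) (hY : Y ∈ g y) (hZ : Z ∈ g z)
    (hT : T ∈ g t) :
    sgn K y z * -B (D (mul X Z)) (mul Y T) =
      -B (D (mul (mul X Y) Z)) T + sgn K x (y + z + t) * -B (D (mul (mul Y Z) T)) X +
        sgn K (x + y) (z + t) * -B (D (mul (mul Z T) X)) Y +
        sgn K t (x + y + z) * -B (D (mul (mul T X) Y)) Z := by
  have hop := congrArg (fun v => B v T) (H.operator _ _ _ _ _ _ hY hX hZ)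
  have hDX := H.odd _ _ hX
  have hDY := H.odd _ _ hY
  have hDZ := H.odd _ _ hZ
  rw [← H.invariant, H.D_skew (H.mul_mem (H.mul_mem hY hZ) hT),
    H.form_mul_rotate (H.mul_mem hY hZ) hT hDX,
    H.D_skew (H.mul_mem (H.mul_mem hZ hT) hX), H.invariant (mul Z T),
    H.form_mul_rotate hZ hT (H.mul_mem hX hDY), H.skew hX hDY,
    H.D_skew (H.mul_mem (H.mul_mem hT hX) hY), H.invariant (mul T X), H.invariant T,
    H.symm hT (H.mul_mem hX (H.mul_mem hY hDZ)), H.skew hX (H.mul_mem hY hDZ), H.skew hY hDZ]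
  rw [H.skew hY hX] at hop
  simp only [map_sub, map_smul, LinearMap.sub_apply, LinearMap.smul_apply, smul_eq_mul] at hop ⊢
  linear_combination (norm := skip) -sgn K x y * hop
  rcases zmod_two_cases x with rfl | rfl <;> rcases zmod_two_cases y with rfl | rfl <;>
    rcases zmod_two_cases z with rfl | rfl <;> rcases zmod_two_cases t with rfl | rfl <;>
    simp only [sgn_zero_left, sgn_zero_right, sgn_one_one, one_add_one_zmod, add_zero,
      zero_add, neg_one_pow_zero_val, neg_one_pow_one_val] <;> ring

lemma identity_coe_coe_coe_coe (H : IsGDEDatum g mul B D A0 mulE)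
    {x y z t : ZMod 2} {X Y Z T : V} (hX : X ∈ g x) (hY : Y ∈ g y)
    (hZ : Z ∈ g z) (hT : T ∈ g t) :
    MalcevIdentity mulE x y z t (0, X, 0) (0, Y, 0) (0, Z, 0) (0, T, 0) := by
  simp only [MalcevIdentity, H.mulE_coe_coe, Prod.smul_mk, Prod.mk_add_mk, smul_zero, add_zero]
  exact Prod.ext rfl (Prod.ext (H.malcev.2.2.2 _ _ _ _ _ _ _ _ hX hY hZ hT)
    (H.cocycle hX hY hZ hT))

lemma identity_e_coe_coe_coe (H : IsGDEDatum g mul B D A0 mulE)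
    {y z t : ZMod 2} {Y Z T : V} (hY : Y ∈ g y)
    (hZ : Z ∈ g z) (hT : T ∈ g t) :
    MalcevIdentity mulE 1 y z t (1, 0, 0) (0, Y, 0) (0, Z, 0) (0, T, 0) := by
  have hop := H.operator _ _ _ _ _ _ hY hZ hT
  have hc := congrArg (fun v => B v T) (H.conds.2.2.2 _ _ _ _ hY hZ)
  have hYZ := H.mul_mem hY hZ
  have hZT := H.mul_mem hZ hT
  have hDZ := H.odd _ _ hZ
  have hDT := H.odd _ _ hT
  have hYDZ := H.mul_mem hY hDZ
  have h3 : B (D (D (mul Z T))) Y = -(sgn K t y * sgn K z y * B (mul (D (D Y)) Z) T) := by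
    rw [H.form_D_D hZT, H.form_mul_rotate hZ hT (H.odd _ _ (H.odd _ _ hY)), add_assoc,
      one_add_one_zmod, add_zero]
  have h4 : B (D (mul (D T) Y)) Z = -((-1) ^ (t + 1 + y).val) * (-((-1) ^ t.val) *
      (sgn K t (y + (z + 1) + 1) * (-sgn K y (z + 1) * B (D (mul (D Z) Y)) T))) := by
    rw [H.D_skew (H.mul_mem hDT hY), H.invariant, H.D_skew hT, H.symm hT (H.odd _ _ hYDZ),
      H.skew hY hDZ]
    simp only [map_smul, LinearMap.smul_apply, smul_eq_mul]
  simp only [MalcevIdentity, H.mulE_coe_coe, H.mulE_e_coe, H.mulE_coe_e hT, H.mulE_coe_e hZT,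
    H.mulE_coe_e (H.mul_mem hYZ hT), Prod.smul_mk, Prod.mk_add_mk, smul_zero, add_zero]
  refine Prod.ext rfl (Prod.ext ?_ ?_)
  · simp only [map_smul, LinearMap.smul_apply]
    linear_combination (norm := skip) hop
    rcases zmod_two_cases y with rfl | rfl <;>
      rcases zmod_two_cases z with rfl | rfl <;> rcases zmod_two_cases t with rfl | rfl <;>
      simp only [sgn_zero_left, sgn_zero_right, sgn_one_one, one_add_one_zmod, add_zero,
        zero_add, neg_one_pow_zero_val, neg_one_pow_one_val] <;> module
  · simp only [map_smul, map_add, map_sub, LinearMap.smul_apply, LinearMap.add_apply,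
      LinearMap.sub_apply, smul_eq_mul] at hc ⊢
    have h0 := H.sgn_one_mul_form (H.mul_mem H.even hYZ) hT
    rw [← H.invariant, H.form_mul_rotate hYZ hT H.even, h3, h4]
    linear_combination (norm := skip) -hc - h0
    rcases zmod_two_cases y with rfl | rfl <;>
      rcases zmod_two_cases z with rfl | rfl <;> rcases zmod_two_cases t with rfl | rfl <;>
      simp only [sgn_zero_left, sgn_zero_right, sgn_one_one, one_add_one_zmod, add_zero,
        zero_add, neg_one_pow_zero_val, neg_one_pow_one_val] <;> ring

lemma form_D_D_D (H : IsGDEDatum g mul B D A0 mulE)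
    {z t : ZMod 2} {Z T : V} (hZ : Z ∈ g z) (hT : T ∈ g t) :
    B (D (D (D T))) Z = sgn K (t + 1) z * ((-1) ^ z.val * B (D (D (D Z))) T) := by
  have h := H.symm (H.odd _ _ (H.odd _ _ (H.odd _ _ hT))) hZ
  have h' : t + 1 + 1 + 1 = t + 1 := by rw [add_assoc t, one_add_one_zmod, add_zero]
  rw [h, h', H.form_D_D (H.odd _ _ hZ), H.D_skew hZ]
  rcases zmod_two_cases z with rfl | rfl <;>
    simp only [neg_one_pow_zero_val, neg_one_pow_one_val] <;> ring

lemma identity_e_e_coe_coe (H : IsGDEDatum g mul B D A0 mulE)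
    {z t : ZMod 2} {Z T : V} (hZ : Z ∈ g z) (hT : T ∈ g t) :
    MalcevIdentity mulE 1 1 z t (1, 0, 0) (1, 0, 0) (0, Z, 0) (0, T, 0) := by
  have hc := H.conds.2.2.1 _ _ _ _ hZ hT
  have hc' := congrArg (fun v => B v T) (H.conds.2.1 Z)
  have hZT := H.mul_mem hZ hT
  have hDZ := H.odd _ _ hZ
  have hDT := H.odd _ _ hT
  have hDA := H.odd _ _ H.even
  simp only [MalcevIdentity, H.mulE_coe_coe, H.mulE_e_coe, H.mulE_e_e, H.mulE_coe_e hT,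
    H.mulE_coe_e hZT, H.mulE_coe_e (H.mul_mem hDZ hT),
    H.mulE_coe_e (Submodule.smul_mem _ _ (H.odd _ _ hZT)),
    H.mulE_coe_e (Submodule.smul_mem _ _ hDT),
    Prod.smul_mk, Prod.mk_add_mk, smul_zero, add_zero]
  refine Prod.ext rfl (Prod.ext ?_ ?_)
  · simp only [map_smul, LinearMap.smul_apply]
    linear_combination (norm := skip) -hc
    rcases zmod_two_cases z with rfl | rfl <;> rcases zmod_two_cases t with rfl | rfl <;>
      simp only [sgn_zero_left, sgn_zero_right, sgn_one_one, one_add_one_zmod, add_zero,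
        zero_add, neg_one_pow_zero_val, neg_one_pow_one_val] <;> module
  · simp only [map_smul, map_sub, LinearMap.smul_apply, LinearMap.sub_apply,
      smul_eq_mul] at hc' ⊢
    have h1 := H.sgn_one_mul_form (H.mul_mem H.even hDZ) hT
    have h2 := H.sgn_one_mul_form (H.mul_mem hDA hZ) hT
    have h3 := H.D_skew (H.odd _ _ hDZ) T
    rw [H.form_mul_rotate hDZ hT H.even, H.D_skew hZT, H.form_mul_rotate hZ hT hDA,
      H.form_D_D_D hZ hT]
    linear_combination (norm := skip) hc' - h1 + h2 - h3
    rcases zmod_two_cases z with rfl | rfl <;> rcases zmod_two_cases t with rfl | rfl <;>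
      simp only [sgn_zero_left, sgn_zero_right, sgn_one_one, one_add_one_zmod, add_zero,
        zero_add, neg_one_pow_zero_val, neg_one_pow_one_val] <;> ring

lemma identity_e_coe_e_coe (H : IsGDEDatum g mul B D A0 mulE)
    {y t : ZMod 2} {Y T : V} (hY : Y ∈ g y) (hT : T ∈ g t) :
    MalcevIdentity mulE 1 y 1 t (1, 0, 0) (0, Y, 0) (1, 0, 0) (0, T, 0) := by
  have hc := H.conds.2.2.2 _ _ _ _ hY hT
  have hc' := congrArg (fun v => B v T) (H.conds.2.1 Y)
  have hDY := H.odd _ _ hY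
  have hDT := H.odd _ _ hT
  have hAY := H.mul_mem H.even hY
  have h4 : B (mul (D T) Y) A0 = (-1) ^ t.val * (sgn K t (0 + y + 1) *
      B (D (mul A0 Y)) T) := by
    rw [H.invariant, H.skew hY H.even, sgn_zero_right, neg_one_smul, map_neg, H.D_skew hT,
      H.symm hT (H.odd _ _ hAY)]
    ring
  simp only [MalcevIdentity, H.mulE_coe_coe, H.mulE_e_coe, H.mulE_e_e, H.mulE_coe_e hT,
    H.mulE_coe_e hY, H.mulE_coe_e hDY, H.mulE_coe_e hDT,
    H.mulE_coe_e (H.mul_mem (Submodule.smul_mem _ _ hDY) hT),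
    H.mulE_coe_e (H.mul_mem (Submodule.smul_mem _ _ hDT) hY),
    Prod.smul_mk, Prod.mk_add_mk, smul_zero, add_zero]
  refine Prod.ext rfl (Prod.ext ?_ ?_)
  · simp only [map_smul, LinearMap.smul_apply]
    linear_combination (norm := skip) (sgn K y 1) • hc
    rcases zmod_two_cases y with rfl | rfl <;> rcases zmod_two_cases t with rfl | rfl <;>
      simp only [sgn_zero_left, sgn_zero_right, sgn_one_one, one_add_one_zmod, add_zero,
        zero_add, neg_one_pow_zero_val, neg_one_pow_one_val] <;> module
  · simp only [map_smul, map_sub, LinearMap.smul_apply, LinearMap.sub_apply,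
      smul_eq_mul] at hc' ⊢
    have h1 := H.sgn_one_mul_form (H.mul_mem H.even hDY) hT
    have h2 := H.sgn_one_mul_form (H.odd _ _ hAY) hT
    rw [← H.invariant, H.form_mul_rotate hDY hT H.even, h4, H.form_D_D_D hY hT]
    linear_combination (norm := skip) (-1) ^ y.val * (h1 - h2 - hc')
    rcases zmod_two_cases y with rfl | rfl <;> rcases zmod_two_cases t with rfl | rfl <;>
      simp only [sgn_zero_left, sgn_zero_right, sgn_one_one, one_add_one_zmod, add_zero,
        zero_add, neg_one_pow_zero_val, neg_one_pow_one_val] <;> ring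

lemma identity_e_e_e_coe (H : IsGDEDatum g mul B D A0 mulE)
    [CharZero K] {t : ZMod 2} {T : V} (hT : T ∈ g t) :
    MalcevIdentity mulE 1 1 1 t (1, 0, 0) (1, 0, 0) (1, 0, 0) (0, T, 0) := by
  have hc := H.conds.2.1 T
  have hDT := H.odd _ _ hT
  simp only [MalcevIdentity, H.mulE_coe_coe, H.mulE_e_coe, H.mulE_e_e, H.mulE_coe_e hT,
    H.mulE_coe_e H.even, H.mulE_coe_e hDT,
    H.mulE_coe_e (Submodule.smul_mem _ _ (Submodule.smul_mem _ _ (H.odd _ _ hDT))),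
    H.mulE_coe_e (H.mul_mem H.even hT),
    H.mulE_coe_e (Submodule.smul_mem _ _ hDT),
    H.mulE_coe_e (Submodule.smul_mem _ _ (H.odd _ _ hDT)),
    Prod.smul_mk, Prod.mk_add_mk, smul_zero, add_zero, map_smul, LinearMap.smul_apply]
  refine Prod.ext rfl (Prod.ext ?_ ?_)
  · linear_combination (norm := skip) hc
    rcases zmod_two_cases t with rfl | rfl <;>
      simp only [sgn_zero_left, sgn_zero_right, sgn_one_one, one_add_one_zmod, add_zero,
        zero_add, neg_one_pow_zero_val, neg_one_pow_one_val] <;> module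
  · have h : B (D A0) (D T) = 0 := by simp [H.D_skew H.even, ← H.form_D_D H.even, H.D_D_eq_zero]
    simp [h, H.D_D_eq_zero, H.form_D_D hT, H.form_mul_rotate H.even hT H.even,
      H.mul_self_eq_zero]

lemma identity_e_e_e_e (H : IsGDEDatum g mul B D A0 mulE) [CharZero K] :
    MalcevIdentity mulE 1 1 1 1 (1, 0, 0) (1, 0, 0) (1, 0, 0) (1, 0, 0) := by
  have h : B (D A0) A0 = 0 := H.form_eq_zero (H.odd _ _ H.even) H.even (by decide)
  simp [MalcevIdentity, H.mulE_coe_coe, H.mulE_e_e, H.mul_self_eq_zero, h, one_add_one_zmod,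
    sgn_one_one, sgn_zero_left]

lemma mulE_mem (H : IsGDEDatum g mul B D A0 mulE)
    {x y : ZMod 2} {X Y : K × V × K} (hX : X ∈ gdeGrading K V g x)
    (hY : Y ∈ gdeGrading K V g y) : mulE X Y ∈ gdeGrading K V g (x + y) := by
  obtain ⟨a, X, c⟩ := X
  obtain ⟨b, Y, d⟩ := Y
  rcases zmod_two_cases x with rfl | rfl <;> rcases zmod_two_cases y with rfl | rfl <;>
    simp only [mem_gdeGrading_zero, mem_gdeGrading_one, one_add_one_zmod, add_zero,
      zero_add] at hX hY ⊢
  · obtain ⟨rfl, hX, rfl⟩ := hX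
    obtain ⟨rfl, hY, rfl⟩ := hY
    rw [H.formula _ _ _ _ _ _ _ _ hX hY]
    simpa [H.form_eq_zero (H.odd _ _ hX) hY (by decide)] using H.mul_mem hX hY
  · obtain ⟨rfl, hX, rfl⟩ := hX
    rw [H.formula _ _ _ _ _ _ _ _ hX hY]
    simpa using sub_mem (H.mul_mem hX hY) (Submodule.smul_mem _ b (H.odd _ _ hX))
  · obtain ⟨rfl, hY, rfl⟩ := hY
    rw [H.formula _ _ _ _ _ _ _ _ hX hY]
    simpa using add_mem (H.mul_mem hX hY) (Submodule.smul_mem _ a (H.odd _ _ hY))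
  · rw [H.formula _ _ _ _ _ _ _ _ hX hY]
    refine ⟨rfl, ?_, ?_⟩
    · exact sub_mem (add_mem (add_mem (Submodule.smul_mem _ _ H.even) (H.mul_mem hX hY))
        (Submodule.smul_mem _ _ (H.odd _ _ hY))) (Submodule.smul_mem _ _ (H.odd _ _ hX))
    · simp [H.form_eq_zero hX H.even (by decide), H.form_eq_zero hY H.even (by decide),
        H.form_eq_zero (H.odd _ _ hX) hY (by decide)]

lemma form_D_swap (H : IsGDEDatum g mul B D A0 mulE)
    {x y : ZMod 2} {X Y : V} (hX : X ∈ g x) (hY : Y ∈ g y) :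
    B (D X) Y = -sgn K x y * B (D Y) X := by
  rw [H.D_skew hX, H.symm hX (H.odd _ _ hY)]
  rcases zmod_two_cases x with rfl | rfl <;> rcases zmod_two_cases y with rfl | rfl <;>
    simp only [sgn_zero_left, sgn_zero_right, sgn_one_one, one_add_one_zmod,
      zero_add, neg_one_pow_zero_val, neg_one_pow_one_val] <;> ring

lemma mulE_skew (H : IsGDEDatum g mul B D A0 mulE)
    {x y : ZMod 2} {X Y : K × V × K} (hX : X ∈ gdeGrading K V g x)
    (hY : Y ∈ gdeGrading K V g y) : mulE X Y = -(sgn K x y) • mulE Y X := by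
  obtain ⟨a, X, c⟩ := X
  obtain ⟨b, Y, d⟩ := Y
  rcases zmod_two_cases x with rfl | rfl <;> rcases zmod_two_cases y with rfl | rfl <;>
    simp only [mem_gdeGrading_zero, mem_gdeGrading_one] at hX hY
  case' inl.inl =>
    obtain ⟨rfl, hX, rfl⟩ := hX
    obtain ⟨rfl, hY, rfl⟩ := hY
  case' inl.inr => obtain ⟨rfl, hX, rfl⟩ := hX
  case' inr.inl => obtain ⟨rfl, hY, rfl⟩ := hY
  all_goals
    rw [H.formula _ _ _ _ _ _ _ _ hX hY, H.formula _ _ _ _ _ _ _ _ hY hX, H.skew hX hY,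
      H.form_D_swap hX hY, Prod.smul_mk, Prod.smul_mk]
    simp only [sgn_zero_left, sgn_zero_right, sgn_one_one, neg_one_pow_zero_val,
      neg_one_pow_one_val, smul_eq_mul]
    refine Prod.ext (by simp) (Prod.ext ?_ ?_)
    · module
    · ring

lemma isMalcevSuper (H : IsGDEDatum g mul B D A0 mulE)
    [CharZero K] : IsMalcevSuper K (K × V × K) (gdeGrading K V g) mulE := by
  refine ⟨isInternal_gdeGrading H.malcev.1, fun _ _ _ _ => H.mulE_mem,
    fun _ _ _ _ => H.mulE_skew, fun x y z t X Y Z T hX hY hZ hT => ?_⟩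
  have rot {x y z t : ZMod 2} {X Y Z T : K × V × K} (hX : X ∈ gdeGrading K V g x)
      (hY : Y ∈ gdeGrading K V g y) (hZ : Z ∈ gdeGrading K V g z) (hT : T ∈ gdeGrading K V g t) :
      MalcevIdentity mulE y z t x Y Z T X → MalcevIdentity mulE x y z t X Y Z T :=
    MalcevIdentity.rotate (fun _ _ _ _ => H.mulE_mem) (fun _ _ _ _ => H.mulE_skew) hX hY hZ hT
  refine MalcevIdentity.of_generators hX fun X gX => rot gX.mem hY hZ hT ?_
  refine MalcevIdentity.of_generators hY fun Y gY => rot gY.mem hZ hT gX.mem ?_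
  refine MalcevIdentity.of_generators hZ fun Z gZ => rot gZ.mem hT gX.mem gY.mem ?_
  refine MalcevIdentity.of_generators hT fun T gT => rot gT.mem gX.mem gY.mem gZ.mem ?_
  have mX := gX.mem
  have mY := gY.mem
  have mZ := gZ.mem
  have mT := gT.mem
  rcases gX with ⟨X, hX, rfl⟩ | ⟨rfl, rfl⟩ | ⟨rfl, rfl⟩
  case inr.inr => simp [MalcevIdentity, H.mulE_star_left, H.mulE_star_right]
  all_goals rcases gY with ⟨Y, hY, rfl⟩ | ⟨rfl, rfl⟩ | ⟨rfl, rfl⟩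
  case inl.inr.inr | inr.inl.inr.inr =>
    simp [MalcevIdentity, H.mulE_star_left, H.mulE_star_right]
  all_goals rcases gZ with ⟨Z, hZ, rfl⟩ | ⟨rfl, rfl⟩ | ⟨rfl, rfl⟩
  all_goals try simp [MalcevIdentity, H.mulE_star_left, H.mulE_star_right]; done
  all_goals rcases gT with ⟨T, hT, rfl⟩ | ⟨rfl, rfl⟩ | ⟨rfl, rfl⟩
  all_goals try simp [MalcevIdentity, H.mulE_star_left, H.mulE_star_right]; done
  · exact H.identity_coe_coe_coe_coe hX hY hZ hT
  · exact rot mX mY mZ mT (rot mY mZ mT mX (rot mZ mT mX mY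
      (H.identity_e_coe_coe_coe hX hY hZ)))
  · exact rot mX mY mZ mT (rot mY mZ mT mX (H.identity_e_coe_coe_coe hT hX hY))
  · exact rot mX mY mZ mT (rot mY mZ mT mX (H.identity_e_e_coe_coe hX hY))
  · exact rot mX mY mZ mT (H.identity_e_coe_coe_coe hZ hT hX)
  · exact rot mX mY mZ mT (H.identity_e_coe_e_coe hZ hX)
  · exact rot mX mY mZ mT (H.identity_e_e_coe_coe hT hX)
  · exact rot mX mY mZ mT (H.identity_e_e_e_coe hX)
  · exact H.identity_e_coe_coe_coe hY hZ hT
  · exact rot mX mY mZ mT (rot mY mZ mT mX (rot mZ mT mX mY (H.identity_e_e_coe_coe hY hZ)))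
  · exact H.identity_e_coe_e_coe hY hT
  · exact rot mX mY mZ mT (rot mY mZ mT mX (H.identity_e_e_e_coe hY))
  · exact H.identity_e_e_coe_coe hZ hT
  · exact rot mX mY mZ mT (rot mY mZ mT mX (rot mZ mT mX mY (H.identity_e_e_e_coe hZ)))
  · exact H.identity_e_e_e_coe hT
  · exact H.identity_e_e_e_e

end IsGDEDatum

end Extension

/-- the generalized double extension `k = Ke ⊕ M ⊕ Ke*` (`e`, `e*` odd), with
`ee = A₀`, `eX = D(X) - (-1)^x B(X,A₀)e*`, `XY = (XY)_M - B(D(X),Y)e*`, `e*k = 0`, is a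
Malcev superalgebra. -/
theorem stmt7 (K : Type) [Field K] [CharZero K] [IsAlgClosed K]
    (V : Type) [AddCommGroup V] [Module K V] [FiniteDimensional K V]
    (g : ZMod 2 → Submodule K V) (mul : V →ₗ[K] V →ₗ[K] V) (B : V →ₗ[K] V →ₗ[K] K)
    (hM : IsMalcevSuper K V g mul) (hQ : IsQuadratic K V g mul B)
    (D : V →ₗ[K] V) (hD1 : IsHomogMap K V g 1 D)
    (hDop : IsMalcevOp K V g mul D) (hDsk : IsSkewSuper K V g B 1 D)
    (A0 : V) (hA0 : A0 ∈ g 0) (hconds : GDEConds K V g mul D A0)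
    (mulE : (K × V × K) →ₗ[K] (K × V × K) →ₗ[K] (K × V × K))
    (hmulE : GDEMulFormula K V g mul B D A0 mulE) :
    IsMalcevSuper K (K × V × K) (gdeGrading K V g) mulE := by
  exact IsGDEDatum.isMalcevSuper ⟨hM, hQ, hD1, hDop, hDsk, hA0, hconds, hmulE⟩
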